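/- Let (M, φ) be a size pair with φ : M → ℝ^k continuous, let (l, b) ∈ Adm_k, and let ε be a real number with 0 < ε < min_{i=1,…,k} l_i. Then for every admissible pair (l′, b′) with ‖(l, b) − (l′, b′)‖_∞ ≤ ε it holds that d_match(ℓ_{(M, F_{(l,b)}^φ)}, ℓ_{(M, F_{(l′,b′)}^φ)}) ≤ ε · (max_{P∈M} ‖φ(P)‖_∞ + ‖l‖_∞ + ‖b‖_∞) / min_{i=1,…,k} { l_i (l_i − ε) }. -/

import Mathlib

open scoped ENNReal Manifold
open Filter

noncomputable section

namespace SizeTheory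

/-- The 1-dimensional size function of the size pair `(M, φ)`: the number of connected
components of the sublevel set `{φ ≤ t}` containing at least one point of `{φ ≤ s}`. -/
def size1 {M : Type*} [TopologicalSpace M] (φ : M → ℝ) (s t : ℝ) : ℕ :=
  {S : Set M | ∃ P : M, φ P ≤ s ∧ S = connectedComponentIn {Q : M | φ Q ≤ t} P}.ncard

/-- The k-dimensional size function of the size pair `(M, φ)`: the number of connected
components of `M⟨φ ⪯ y⟩` containing at least one point of `M⟨φ ⪯ x⟩`. -/
def sizek {M : Type*} [TopologicalSpace M] {k : ℕ} (φ : M → Fin k → ℝ)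
    (x y : Fin k → ℝ) : ℕ :=
  {S : Set M | ∃ P : M, (∀ i, φ P i ≤ x i) ∧
    S = connectedComponentIn {Q : M | ∀ i, φ Q i ≤ y i} P}.ncard

/-- Multiplicity of a (candidate) proper cornerpoint `(x, y)` of a 1-dimensional size
function `ℓ`. -/
def mult (ℓ : ℝ → ℝ → ℕ) (x y : ℝ) : ℤ :=
  sInf {v : ℤ | ∃ ε : ℝ, 0 < ε ∧ x + ε < y - ε ∧
    v = (ℓ (x + ε) (y - ε) : ℤ) - (ℓ (x - ε) (y - ε) : ℤ)
      - (ℓ (x + ε) (y + ε) : ℤ) + (ℓ (x - ε) (y + ε) : ℤ)}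

/-- Multiplicity of a (candidate) cornerpoint at infinity `(a, ∞)` of a 1-dimensional size
function `ℓ`. -/
def multInf (ℓ : ℝ → ℝ → ℕ) (a : ℝ) : ℤ :=
  sInf {v : ℤ | ∃ ε : ℝ, 0 < ε ∧ a + ε < 1 / ε ∧
    v = (ℓ (a + ε) (1 / ε) : ℤ) - (ℓ (a - ε) (1 / ε) : ℤ)}

/-- `(x, y)` is a proper cornerpoint of the 1-dimensional size function `ℓ`. -/
def IsProperCornerpoint (ℓ : ℝ → ℝ → ℕ) (x y : ℝ) : Prop :=
  x < y ∧ 0 < mult ℓ x y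

/-- `(a, ∞)` is a cornerpoint at infinity (cornerline) of the 1-dimensional size
function `ℓ`. -/
def IsCornerpointAtInfinity (ℓ : ℝ → ℝ → ℕ) (a : ℝ) : Prop :=
  0 < multInf ℓ a

/-- The cost `(y - x)/2` of moving a point of `Δ̄*` (points `(x, y)` with `y` possibly `∞`)
onto the diagonal. -/
def diagHalf (p : ℝ × WithTop ℝ) : ℝ≥0∞ :=
  WithTop.recTopCoe ⊤ (fun y => ENNReal.ofReal ((y - p.1) / 2)) p.2

/-- `|y - y'|` for ordinates in `ℝ ∪ {∞}`, with the conventions `∞ - y = y - ∞ = ∞`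
for `y ≠ ∞` and `∞ - ∞ = 0`. -/
def yDist (y y' : WithTop ℝ) : ℝ≥0∞ :=
  WithTop.recTopCoe (WithTop.recTopCoe 0 (fun _ => (⊤ : ℝ≥0∞)) y')
    (fun a => WithTop.recTopCoe ⊤ (fun b => ENNReal.ofReal |a - b|) y') y

/-- The pseudometric `δ` used in the definition of the matching distance. -/
def deltaCP (p q : ℝ × WithTop ℝ) : ℝ≥0∞ :=
  min (max (ENNReal.ofReal |p.1 - q.1|) (yDist p.2 q.2)) (max (diagHalf p) (diagHalf q))

/-- The multiplicity, in the augmented multiset of cornerpoints of the 1-dimensional size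
function `ℓ`, of a point `p` of `Δ̄*`: cornerpoints (proper or at infinity) are counted
with their multiplicities, and the points of the diagonal with infinite multiplicity. -/
def cpMult (ℓ : ℝ → ℝ → ℕ) (p : ℝ × WithTop ℝ) : ℕ∞ :=
  WithTop.recTopCoe ((multInf ℓ p.1).toNat : ℕ∞)
    (fun y => if p.1 = y then (⊤ : ℕ∞)
      else if p.1 < y then ((mult ℓ p.1 y).toNat : ℕ∞) else 0) p.2

/-- The underlying "index type" of a multiset of points of `Δ̄*` described by the
multiplicity function `m`: each point `p` appears with multiplicity `m p`. -/
def CPIdx (m : ℝ × WithTop ℝ → ℕ∞) : Type :=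
  Σ p : ℝ × WithTop ℝ, {n : ℕ // (n : ℕ∞) < m p}

/-- The matching distance between two 1-dimensional size functions: the infimum, over all
bijections `σ` between the two augmented multisets of cornerpoints, of the supremum of
`δ(P, σ(P))`. -/
def dMatch (ℓ₁ ℓ₂ : ℝ → ℝ → ℕ) : ℝ≥0∞ :=
  ⨅ σ : CPIdx (cpMult ℓ₁) ≃ CPIdx (cpMult ℓ₂),
    ⨆ a : CPIdx (cpMult ℓ₁), deltaCP a.1 ((σ a).1)

/-- `(l, b)` is an admissible pair: `l` is a unit vector (Euclidean norm) with strictly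
positive components, and the components of `b` sum to zero. -/
def Admissible {k : ℕ} (l b : Fin k → ℝ) : Prop :=
  Real.sqrt (∑ i, l i ^ 2) = 1 ∧ (∀ i, 0 < l i) ∧ ∑ i, b i = 0

/-- The 1-dimensional measuring function `F_{(l,b)}^φ (P) = max_i (φ_i(P) - b_i)/l_i`
corresponding to the half-plane `π_{(l,b)}`. -/
def Fpair {M : Type*} {k : ℕ} (φ : M → Fin k → ℝ) (l b : Fin k → ℝ) (P : M) : ℝ :=
  ⨆ i, (φ P i - b i) / l i

section ManifoldDefs

variable {E : Type*} [NormedAddCommGroup E] [InnerProductSpace ℝ E] [FiniteDimensional ℝ E]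
  {H : Type*} [TopologicalSpace H] (I : ModelWithCorners ℝ E H)
  {M : Type*} [TopologicalSpace M] [ChartedSpace H M]

/-- The differential (gradient, up to the Riemannian identification) at `Q` of the `i`-th
component of `φ : M → ℝ^k`, seen as a covector at `Q`. -/
def dcomp {k : ℕ} (φ : M → Fin k → ℝ) (Q : M) (i : Fin k) :
    TangentSpace I Q →L[ℝ] ℝ :=
  mfderiv I 𝓘(ℝ, ℝ) (fun P => φ P i) Q

/-- `Q` is an `(l, b)`-pseudocritical point for `φ`: the convex hull of the differentials
`dφ_i(Q)`, for the indices `i ∈ I_Q` realizing the maximum defining `F_{(l,b)}^φ (Q)`,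
contains the null (co)vector. -/
def LBPseudocritPt {k : ℕ} (l b : Fin k → ℝ) (φ : M → Fin k → ℝ) (Q : M) : Prop :=
  ∃ lam : Fin k → ℝ, (∀ i, 0 ≤ lam i) ∧ (∀ i, lam i ≤ 1) ∧
    (∀ i, lam i ≠ 0 → (φ Q i - b i) / l i = Fpair φ l b Q) ∧
    (∑ i, lam i) = 1 ∧ (∑ i, lam i • dcomp I φ Q i) = 0

/-- `c` is an `(l, b)`-pseudocritical value for `φ`. -/
def LBPseudocritVal {k : ℕ} (l b : Fin k → ℝ) (φ : M → Fin k → ℝ) (c : ℝ) : Prop :=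
  ∃ Q : M, Fpair φ l b Q = c ∧ LBPseudocritPt I l b φ Q

/-- `ξ : M → ℝ^h` is `C¹` at the point `Q`. -/
def C1At {h : ℕ} (ξ : M → Fin h → ℝ) (Q : M) : Prop :=
  ∀ j, ContMDiffAt I 𝓘(ℝ, ℝ) 1 (fun P => ξ P j) Q

/-- `Q` is a pseudocritical point for `ξ : M → ℝ^h`: `ξ` is `C¹` at `Q` and the convex hull
of the differentials `dξ_1(Q), …, dξ_h(Q)` contains the null (co)vector. -/
def PseudocritPt {h : ℕ} (ξ : M → Fin h → ℝ) (Q : M) : Prop :=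
  C1At I ξ Q ∧
  ∃ lam : Fin h → ℝ, (∀ j, 0 ≤ lam j) ∧ (∀ j, lam j ≤ 1) ∧
    (∑ j, lam j) = 1 ∧ (∑ j, lam j • dcomp I ξ Q j) = 0

/-- `v` is a pseudocritical value for `ξ`. -/
def PseudocritVal {h : ℕ} (ξ : M → Fin h → ℝ) (v : Fin h → ℝ) : Prop :=
  ∃ Q : M, ξ Q = v ∧ PseudocritPt I ξ Q

/-- `v` is a special value for `ξ`: `v` is the image of a point at which `ξ` is not `C¹`. -/
def SpecialVal {h : ℕ} (ξ : M → Fin h → ℝ) (v : Fin h → ℝ) : Prop :=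
  ∃ Q : M, ξ Q = v ∧ ¬ C1At I ξ Q

end ManifoldDefs

section BarMatching

/-- An integer valued infimum of a monotone family indexed by small positive reals is
eventually attained. -/
theorem exists_forall_le_eq_sInf (u : ℝ → ℤ) (p : ℝ → Prop) (hne : ∃ ε, 0 < ε ∧ p ε)
    (hp : ∀ ε ε', 0 < ε → ε ≤ ε' → p ε' → p ε) (hu : ∀ ε, 0 < ε → p ε → 0 ≤ u ε)
    (hmono : ∀ ε ε', 0 < ε → ε ≤ ε' → p ε' → u ε ≤ u ε') :
    ∃ ε₀, 0 < ε₀ ∧ p ε₀ ∧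
      ∀ ε, 0 < ε → ε ≤ ε₀ → u ε = sInf {v : ℤ | ∃ ε : ℝ, 0 < ε ∧ p ε ∧ v = u ε} := by
  set S := {v : ℤ | ∃ ε : ℝ, 0 < ε ∧ p ε ∧ v = u ε} with hS
  have hbdd : BddBelow S := ⟨0, by rintro _ ⟨ε, h1, h2, rfl⟩; exact hu ε h1 h2⟩
  have hmem : sInf S ∈ S := by
    obtain ⟨ε, h1, h2⟩ := hne
    exact Int.csInf_mem ⟨u ε, ε, h1, h2, rfl⟩ hbdd
  obtain ⟨ε₀, h0, hp0, h⟩ := hmem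
  refine ⟨ε₀, h0, hp0, fun ε hε hle => le_antisymm ?_ ?_⟩
  · rw [h]
    exact hmono _ _ hε hle hp0
  · exact csInf_le hbdd ⟨ε, hε, hp _ _ hε hle hp0, rfl⟩

/-- The properties shared by the functions counting the components of a sublevel set that meet
another sublevel set. -/
structure IsRank (r : ℝ → ℝ → ℕ) : Prop where
  box : ∀ {s s' t t' : ℝ}, s ≤ s' → s' < t → t ≤ t' → r s' t' + r s t ≤ r s' t + r s t'
  mono : ∀ {s s' t : ℝ}, s ≤ s' → s' < t → r s t ≤ r s' t
  anti : ∀ {s t t' : ℝ}, s < t → t ≤ t' → r s t' ≤ r s t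

/-- The number of classes born at `b` and still alive at `y`. -/
def bornAt (r : ℝ → ℝ → ℕ) (b y : ℝ) : ℤ :=
  sInf {v : ℤ | ∃ ε : ℝ, 0 < ε ∧ b + ε < y ∧ v = (r (b + ε) y : ℤ) - (r (b - ε) y : ℤ)}

variable {r r₁ r₂ : ℝ → ℝ → ℕ}

theorem IsRank.bornAt_spec (hr : IsRank r) {b y : ℝ} (h : b < y) :
    ∃ ε₀, 0 < ε₀ ∧ b + ε₀ < y ∧
      ∀ ε, 0 < ε → ε ≤ ε₀ → (r (b + ε) y : ℤ) - (r (b - ε) y : ℤ) = bornAt r b y := by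
  refine exists_forall_le_eq_sInf (fun ε => (r (b + ε) y : ℤ) - (r (b - ε) y : ℤ))
    (fun ε => b + ε < y) ⟨(y - b) / 2, by linarith, by linarith⟩ ?_ ?_ ?_
  · intro ε ε' _ _ _
    linarith
  · intro ε h1 h2
    have := hr.mono (show b - ε ≤ b + ε by linarith) h2
    omega
  · intro ε ε' h1 h2 h3
    have h4 := hr.mono (show b + ε ≤ b + ε' by linarith) h3
    have h5 := hr.mono (show b - ε' ≤ b - ε by linarith) (show b - ε < y by linarith)
    omega

theorem bornAt_le_bornAt (hr₁ : IsRank r₁) (hr₂ : IsRank r₂) {b y₁ y₂ : ℝ} (h₁ : b < y₁)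
    (h₂ : b < y₂)
    (h : ∀ s s', s ≤ s' → s' < y₁ → s' < y₂ → r₂ s' y₂ + r₁ s y₁ ≤ r₁ s' y₁ + r₂ s y₂) :
    bornAt r₂ b y₂ ≤ bornAt r₁ b y₁ := by
  obtain ⟨ε₁, hε₁, hy₁, e₁⟩ := hr₁.bornAt_spec h₁
  obtain ⟨ε₂, hε₂, hy₂, e₂⟩ := hr₂.bornAt_spec h₂
  have hm := min_le_left ε₁ ε₂
  have hm' := min_le_right ε₁ ε₂
  have hm0 := lt_min hε₁ hε₂
  rw [← e₁ _ hm0 hm, ← e₂ _ hm0 hm']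
  have := h (b - min ε₁ ε₂) (b + min ε₁ ε₂) (by linarith) (by linarith) (by linarith)
  omega

theorem IsRank.bornAt_anti (hr : IsRank r) {b y y' : ℝ} (h : b < y) (h' : y ≤ y') :
    bornAt r b y' ≤ bornAt r b y :=
  bornAt_le_bornAt hr hr h (h.trans_le h') fun _ _ h1 h2 _ => hr.box h1 h2 h'

theorem IsRank.bornAt_nonneg (hr : IsRank r) {b y : ℝ} (h : b < y) : 0 ≤ bornAt r b y := by
  obtain ⟨ε, hε, hy, e⟩ := hr.bornAt_spec h
  rw [← e ε hε le_rfl]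
  have := hr.mono (show b - ε ≤ b + ε by linarith) hy
  omega

theorem IsRank.bornAt_eq_zero (hr : IsRank r) {b y : ℝ} (h : b < y)
    (h0 : ∀ s, s < y → r s y = 0) : bornAt r b y = 0 := by
  obtain ⟨ε, hε, hy, e⟩ := hr.bornAt_spec h
  rw [← e ε hε le_rfl, h0 _ hy, h0 _ (by linarith)]
  simp

theorem IsRank.mult_spec (hr : IsRank r) {x y : ℝ} (h : x < y) :
    ∃ ε₀, 0 < ε₀ ∧ x + ε₀ < y - ε₀ ∧
      ∀ ε ε', 0 < ε → ε ≤ ε₀ → 0 < ε' → ε' ≤ ε₀ →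
        (r (x + ε) (y - ε') : ℤ) - (r (x - ε) (y - ε') : ℤ)
          - (r (x + ε) (y + ε') : ℤ) + (r (x - ε) (y + ε') : ℤ) = mult r x y := by
  have key : ∀ {ε₁ ε₂ ε₁' ε₂' : ℝ}, 0 < ε₁ → ε₁ ≤ ε₂ → 0 < ε₁' → ε₁' ≤ ε₂' →
      x + ε₂ < y - ε₂' →
      (r (x + ε₁) (y - ε₁') : ℤ) - (r (x - ε₁) (y - ε₁') : ℤ)
          - (r (x + ε₁) (y + ε₁') : ℤ) + (r (x - ε₁) (y + ε₁') : ℤ) ≤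
      (r (x + ε₂) (y - ε₂') : ℤ) - (r (x - ε₂) (y - ε₂') : ℤ)
          - (r (x + ε₂) (y + ε₂') : ℤ) + (r (x - ε₂) (y + ε₂') : ℤ) := by
    intro ε₁ ε₂ ε₁' ε₂' h1 h2 h3 h4 h5
    have b1 := hr.box (show x + ε₁ ≤ x + ε₂ by linarith) (show x + ε₂ < y - ε₁' by linarith)
      (show y - ε₁' ≤ y + ε₁' by linarith)
    have b2 := hr.box (show x - ε₂ ≤ x - ε₁ by linarith) (show x - ε₁ < y - ε₁' by linarith)
      (show y - ε₁' ≤ y + ε₁' by linarith)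
    have b3 := hr.box (show x - ε₂ ≤ x + ε₂ by linarith) (show x + ε₂ < y - ε₂' by linarith)
      (show y - ε₂' ≤ y - ε₁' by linarith)
    have b4 := hr.box (show x - ε₂ ≤ x + ε₂ by linarith) (show x + ε₂ < y + ε₁' by linarith)
      (show y + ε₁' ≤ y + ε₂' by linarith)
    omega
  obtain ⟨ε₀, h0, hp, e⟩ := exists_forall_le_eq_sInf
    (fun ε => (r (x + ε) (y - ε) : ℤ) - (r (x - ε) (y - ε) : ℤ)
          - (r (x + ε) (y + ε) : ℤ) + (r (x - ε) (y + ε) : ℤ))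
    (fun ε => x + ε < y - ε) ⟨(y - x) / 4, by linarith, by linarith⟩
    (fun ε ε' _ _ _ => by linarith)
    (fun ε h1 h2 => by
      have := hr.box (show x - ε ≤ x + ε by linarith) h2 (show y - ε ≤ y + ε by linarith)
      omega)
    (fun ε ε' h1 h2 h3 => key h1 h2 h1 h2 h3)
  refine ⟨ε₀, h0, hp, fun ε ε' h1 h2 h3 h4 => le_antisymm ?_ ?_⟩
  · have hM := max_le h2 h4
    refine (key h1 (le_max_left ε ε') h3 (le_max_right ε ε') (by linarith)).trans ?_
    exact (e (max ε ε') (lt_max_of_lt_left h1) hM).le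
  · have hm := lt_min h1 h3
    refine le_trans ?_ (key hm (min_le_left ε ε') hm (min_le_right ε ε') (by linarith))
    exact (e (min ε ε') hm ((min_le_left _ _).trans h2)).ge

theorem IsRank.bornAt_drop (hr : IsRank r) {b y : ℝ} (h : b < y) :
    ∃ v : ℤ, 0 ≤ v ∧ ∃ ε₀, 0 < ε₀ ∧ b < y - ε₀ ∧
      ∀ ε, 0 < ε → ε ≤ ε₀ → bornAt r b (y + ε) = v ∧ bornAt r b (y - ε) = v + mult r b y := by
  obtain ⟨ε₀, h0, hp, e⟩ := hr.mult_spec h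
  have key : ∀ ε, 0 < ε → ε ≤ ε₀ →
      bornAt r b (y - ε) = bornAt r b (y + ε) + mult r b y := by
    intro ε h1 h2
    obtain ⟨ε₁, hε₁, hy₁, e₁⟩ := hr.bornAt_spec (show b < y - ε by linarith)
    obtain ⟨ε₂, hε₂, hy₂, e₂⟩ := hr.bornAt_spec (show b < y + ε by linarith)
    have hm : 0 < min ε₀ (min ε₁ ε₂) := lt_min h0 (lt_min hε₁ hε₂)
    have i1 : min ε₀ (min ε₁ ε₂) ≤ ε₁ := (min_le_right _ _).trans (min_le_left _ _)
    have i2 : min ε₀ (min ε₁ ε₂) ≤ ε₂ := (min_le_right _ _).trans (min_le_right _ _)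
    rw [← e₁ _ hm i1, ← e₂ _ hm i2, ← e _ ε hm (min_le_left _ _) h1 h2]
    ring
  refine ⟨bornAt r b (y + ε₀), hr.bornAt_nonneg (by linarith), ε₀, h0, by linarith,
    fun ε h1 h2 => ?_⟩
  have k1 := key ε h1 h2
  have k2 := key ε₀ h0 le_rfl
  have a1 := hr.bornAt_anti (show b < y + ε by linarith) (show y + ε ≤ y + ε₀ by linarith)
  have a2 := hr.bornAt_anti (show b < y - ε₀ by linarith) (show y - ε₀ ≤ y - ε by linarith)
  omega

/-- The proper cornerpoints of `r`, repeated according to their multiplicity. -/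
def bars (r : ℝ → ℝ → ℕ) : Set (ℝ × ℝ × ℕ) :=
  {p | p.1 < p.2.1 ∧ (p.2.2 : ℤ) < mult r p.1 p.2.1}

/-- Bars with a common birth can be numbered by decreasing deaths. -/
theorem IsRank.exists_numbering (hr : IsRank r) {K : ℝ}
    (hK : ∀ s t, s < t → K ≤ t → r s t = 0) :
    ∃ e : ℝ × ℝ × ℕ → ℤ,
      (∀ p ∈ bars r, 0 ≤ e p) ∧
      (∀ p ∈ bars r, ∀ z, p.1 < z → z < p.2.1 → e p < bornAt r p.1 z) ∧
      (∀ p ∈ bars r, ∀ z, p.2.1 < z → bornAt r p.1 z ≤ e p) ∧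
      (∀ p ∈ bars r, ∀ q ∈ bars r, p.1 = q.1 → e p = e q → p = q) ∧
      (∀ b y j, b < y → 0 ≤ j → j < bornAt r b y → ∃ p ∈ bars r, p.1 = b ∧ e p = j) := by
  have hd : ∀ b y, ∃ v : ℤ, b < y → 0 ≤ v ∧ ∃ ε₀, 0 < ε₀ ∧ b < y - ε₀ ∧
      ∀ ε, 0 < ε → ε ≤ ε₀ →
        bornAt r b (y + ε) = v ∧ bornAt r b (y - ε) = v + mult r b y := by
    intro b y
    by_cases h : b < y
    · obtain ⟨v, hv⟩ := hr.bornAt_drop h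
      exact ⟨v, fun _ => hv⟩
    · exact ⟨0, fun h' => absurd h' h⟩
  choose v hv using hd
  have hlow : ∀ p ∈ bars r, ∀ z, p.1 < z → z < p.2.1 →
      v p.1 p.2.1 + p.2.2 < bornAt r p.1 z := by
    intro p hp z h1 h2
    obtain ⟨-, ε₀, h0, h3, h4⟩ := hv _ _ hp.1
    have hm : 0 < min ε₀ (p.2.1 - z) := lt_min h0 (by linarith)
    have h5 := (h4 _ hm (min_le_left _ _)).2
    have h6 := min_le_right ε₀ (p.2.1 - z)
    have h7 := hr.bornAt_anti h1 (show z ≤ p.2.1 - min ε₀ (p.2.1 - z) by linarith)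
    have h8 := hp.2
    omega
  have hhigh : ∀ p ∈ bars r, ∀ z, p.2.1 < z → bornAt r p.1 z ≤ v p.1 p.2.1 + p.2.2 := by
    intro p hp z h2
    obtain ⟨-, ε₀, h0, h3, h4⟩ := hv _ _ hp.1
    have hm : 0 < min ε₀ (z - p.2.1) := lt_min h0 (by linarith)
    have h5 := (h4 _ hm (min_le_left _ _)).1
    have h6 := min_le_right ε₀ (z - p.2.1)
    have h7 := hr.bornAt_anti (show p.1 < p.2.1 + min ε₀ (z - p.2.1) by linarith [hp.1])
      (show p.2.1 + min ε₀ (z - p.2.1) ≤ z by linarith)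
    omega
  refine ⟨fun p => v p.1 p.2.1 + p.2.2, ?_, hlow, hhigh, ?_, ?_⟩
  · intro p hp
    exact add_nonneg (hv _ _ hp.1).1 (Int.natCast_nonneg _)
  · have hle : ∀ p ∈ bars r, ∀ q ∈ bars r, p.1 = q.1 →
        v p.1 p.2.1 + p.2.2 = v q.1 q.2.1 + q.2.2 → p.2.1 ≤ q.2.1 := by
      intro p hp q hq h1 h2
      by_contra! h3
      obtain ⟨z, hz1, hz2⟩ := exists_between h3
      have h4 := hlow p hp z (by rw [h1]; exact hq.1.trans hz1) hz2
      have h5 := hhigh q hq z hz1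
      rw [h1] at h4 h2
      omega
    rintro ⟨x, y, n⟩ hp ⟨x', y', n'⟩ hq h1 h2
    have h3 := le_antisymm (hle _ hp _ hq h1 h2) (hle _ hq _ hp h1.symm h2.symm)
    simp only at h1 h2 h3
    subst h1 h3
    simp only [Prod.mk.injEq, true_and]
    omega
  · intro b y j hby hj hlt
    set S := {z | b < z ∧ j < bornAt r b z} with hS
    have hbdd : BddAbove S := by
      refine ⟨K, fun z hz => ?_⟩
      by_contra! hKz
      have := hr.bornAt_eq_zero hz.1 (fun s hs => hK s z hs hKz.le)
      have := hz.2
      omega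
    have hyS : y ∈ S := ⟨hby, hlt⟩
    have hbD : b < sSup S := hby.trans_le (le_csSup hbdd hyS)
    obtain ⟨hv0, ε₀, h0, h3, h4⟩ := hv b _ hbD
    obtain ⟨h5, h6⟩ := h4 ε₀ h0 le_rfl
    have h7 : bornAt r b (sSup S + ε₀) ≤ j := by
      by_contra! hc
      have := le_csSup hbdd (show sSup S + ε₀ ∈ S from ⟨by linarith, hc⟩)
      linarith
    have h8 : j < bornAt r b (sSup S - ε₀) := by
      obtain ⟨z, hz, hz'⟩ := exists_lt_of_lt_csSup ⟨y, hyS⟩ (show sSup S - ε₀ < sSup S by linarith)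
      exact hz.2.trans_le (hr.bornAt_anti h3 hz'.le)
    refine ⟨(b, sSup S, (j - v b (sSup S)).toNat), ⟨hbD, ?_⟩, rfl, ?_⟩ <;> simp only <;> omega

/-- A matching of bars preserving births. -/
theorem IsRank.exists_birth_matching (hr₁ : IsRank r₁) (hr₂ : IsRank r₂) {K a : ℝ} (ha : 0 ≤ a)
    (hK₁ : ∀ s t, s < t → K ≤ t → r₁ s t = 0) (hK₂ : ∀ s t, s < t → K ≤ t → r₂ s t = 0)
    (h : ∀ s s' t, s ≤ s' → s' < t → r₂ s' t + r₁ s t ≤ r₁ s' t + r₂ s t)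
    (h' : ∀ s s' t, s ≤ s' → s' < t →
      r₁ s' (t + a) + r₂ s t ≤ r₂ s' t + r₁ s (t + a)) :
    ∃ m : bars r₂ → bars r₁, Function.Injective m ∧
      (∀ p, (m p).1.1 = p.1.1 ∧ p.1.2.1 ≤ (m p).1.2.1 ∧ (m p).1.2.1 ≤ p.1.2.1 + a) ∧
      ∀ q, q ∉ Set.range m → q.1.2.1 - q.1.1 ≤ a := by
  obtain ⟨e₁, nn₁, lo₁, hi₁, inj₁, surj₁⟩ := hr₁.exists_numbering hK₁
  obtain ⟨e₂, nn₂, lo₂, hi₂, inj₂, surj₂⟩ := hr₂.exists_numbering hK₂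
  have hle : ∀ b z, b < z → bornAt r₂ b z ≤ bornAt r₁ b z := fun b z hz =>
    bornAt_le_bornAt hr₁ hr₂ hz hz fun s s' h1 h2 _ => h s s' z h1 h2
  have hle' : ∀ b z, b < z → bornAt r₁ b (z + a) ≤ bornAt r₂ b z := fun b z hz =>
    bornAt_le_bornAt hr₂ hr₁ hz (by linarith) fun s s' h1 h2 _ => h' s s' z h1 h2
  have hex : ∀ p : bars r₂, ∃ q : bars r₁, q.1.1 = p.1.1 ∧ e₁ q = e₂ p := by
    rintro ⟨p, hp⟩
    obtain ⟨z, hz1, hz2⟩ := exists_between hp.1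
    obtain ⟨q, hq, h1, h2⟩ := surj₁ p.1 z (e₂ p) hz1 (nn₂ p hp)
      ((lo₂ p hp z hz1 hz2).trans_le (hle _ _ hz1))
    exact ⟨⟨q, hq⟩, h1, h2⟩
  choose m hm1 hm2 using hex
  refine ⟨m, ?_, ?_, ?_⟩
  · intro p q hpq
    refine Subtype.ext (inj₂ _ p.2 _ q.2 ?_ ?_)
    · rw [← hm1, ← hm1, hpq]
    · rw [← hm2, ← hm2, hpq]
  · intro p
    refine ⟨hm1 p, ?_, ?_⟩
    · by_contra! hc
      obtain ⟨z, hz1, hz2⟩ := exists_between hc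
      have hz0 := (m p).2.1.trans hz1
      have i1 := hi₁ _ (m p).2 z hz1
      rw [hm1] at hz0 i1
      have i2 := lo₂ _ p.2 z hz0 hz2
      have i3 := hle _ _ hz0
      rw [hm2] at i1
      omega
    · by_contra! hc
      obtain ⟨z, hz1, hz2⟩ := exists_between hc
      have hz0 : p.1.1 < z - a := by linarith [p.2.1]
      have i1 := lo₁ _ (m p).2 z (by rw [hm1]; linarith) hz2
      have i2 := hi₂ _ p.2 (z - a) (by linarith)
      have i3 := hle' _ _ hz0
      rw [hm1, hm2] at i1
      rw [sub_add_cancel] at i3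
      omega
  · intro q hq
    by_contra! hc
    obtain ⟨z, hz1, hz2⟩ := exists_between hc
    have i1 := lo₁ _ q.2 (q.1.1 + z) (by linarith) (by linarith)
    have i2 := hle' q.1.1 (q.1.1 + z - a) (by linarith)
    rw [sub_add_cancel] at i2
    obtain ⟨p, hp, h1, h2⟩ := surj₂ _ _ _ (by linarith) (nn₁ _ q.2) (i1.trans_le i2)
    refine hq ⟨⟨p, hp⟩, Subtype.ext (inj₁ _ (m ⟨p, hp⟩).2 _ q.2 ?_ ?_)⟩
    · rw [hm1, h1]
    · rw [hm2, h2]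

/-- Time reversal. -/
def reverse (r : ℝ → ℝ → ℕ) (s t : ℝ) : ℕ := r (-t) (-s)

theorem IsRank.reverse (hr : IsRank r) : IsRank (reverse r) where
  mono h1 h2 := hr.anti (neg_lt_neg h2) (neg_le_neg h1)
  anti h1 h2 := hr.mono (neg_le_neg h2) (neg_lt_neg h1)
  box h1 h2 h3 := by
    have := hr.box (neg_le_neg h3) (neg_lt_neg h2) (neg_le_neg h1)
    simp only [SizeTheory.reverse]
    omega

theorem mult_reverse (x y : ℝ) : mult (reverse r) x y = mult r (-y) (-x) := by
  unfold mult reverse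
  congr 1
  ext v
  refine exists_congr fun ε => and_congr_right fun _ => and_congr ?_ ?_
  · constructor <;> intro _ <;> linarith
  · rw [show -(y - ε) = -y + ε by ring, show -(y + ε) = -y - ε by ring,
      show -(x - ε) = -x + ε by ring, show -(x + ε) = -x - ε by ring]
    constructor <;> intro _ <;> linarith

/-- The reversal of bars. -/
def barsReverse (r : ℝ → ℝ → ℕ) : bars r ≃ bars (reverse r) where
  toFun p := ⟨(-p.1.2.1, -p.1.1, p.1.2.2), neg_lt_neg p.2.1, by
    have := p.2.2
    simpa [mult_reverse] using this⟩
  invFun p := ⟨(-p.1.2.1, -p.1.1, p.1.2.2), neg_lt_neg p.2.1, by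
    have := p.2.2
    simpa [mult_reverse] using this⟩
  left_inv p := by simp
  right_inv p := by simp

/-- A matching of bars preserving deaths. -/
theorem IsRank.exists_death_matching (hr₁ : IsRank r₁) (hr₂ : IsRank r₂) {L a : ℝ} (ha : 0 ≤ a)
    (hL₁ : ∀ s t, s < t → s ≤ L → r₁ s t = 0) (hL₂ : ∀ s t, s < t → s ≤ L → r₂ s t = 0)
    (h : ∀ s t t', s < t → t ≤ t' → r₂ s t + r₁ s t' ≤ r₁ s t + r₂ s t')
    (h' : ∀ s t t', s < t → t ≤ t' →
      r₁ (s - a) t + r₂ s t' ≤ r₂ s t + r₁ (s - a) t') :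
    ∃ m : bars r₂ → bars r₁, Function.Injective m ∧
      (∀ p, (m p).1.2.1 = p.1.2.1 ∧ p.1.1 - a ≤ (m p).1.1 ∧ (m p).1.1 ≤ p.1.1) ∧
      ∀ q, q ∉ Set.range m → q.1.2.1 - q.1.1 ≤ a := by
  obtain ⟨m, hinj, hm, hq⟩ := hr₁.reverse.exists_birth_matching hr₂.reverse (K := -L) ha
    (fun s t h1 h2 => hL₁ _ _ (neg_lt_neg h1) (by linarith))
    (fun s t h1 h2 => hL₂ _ _ (neg_lt_neg h1) (by linarith))
    (fun s s' t h1 h2 => h _ _ _ (neg_lt_neg h2) (neg_le_neg h1))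
    (fun s s' t h1 h2 => by
      have := h' _ _ _ (neg_lt_neg h2) (neg_le_neg h1)
      simp only [SizeTheory.reverse, neg_add']
      omega)
  refine ⟨fun p => (barsReverse r₁).symm (m (barsReverse r₂ p)),
    (barsReverse r₁).symm.injective.comp (hinj.comp (barsReverse r₂).injective), ?_, ?_⟩
  · intro p
    obtain ⟨h1, h2, h3⟩ := hm (barsReverse r₂ p)
    simp only [barsReverse, Equiv.coe_fn_mk, Equiv.coe_fn_symm_mk] at h1 h2 h3 ⊢
    refine ⟨?_, ?_, ?_⟩ <;> linarith
  · intro q hq'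
    have := hq (barsReverse r₁ q) (by
      rintro ⟨p, hp⟩
      refine hq' ⟨(barsReverse r₂).symm p, ?_⟩
      simp [hp])
    simp only [barsReverse, Equiv.coe_fn_mk] at this
    linarith

end BarMatching

section ComponentCount

variable {M : Type*} [TopologicalSpace M]

/-- The connected components of `B` meeting `A`. -/
def componentsMeeting (A B : Set M) : Set (Set M) := connectedComponentIn B '' A

theorem finite_componentsMeeting [CompactSpace M] [LocallyConnectedSpace M] {A U B : Set M}
    (hA : IsClosed A) (hU : IsOpen U) (hAU : A ⊆ U) (hUB : U ⊆ B) :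
    (componentsMeeting A B).Finite := by
  obtain ⟨t, htA, ht⟩ := hA.isCompact.elim_nhds_subcover (connectedComponentIn U)
    (fun x hx => hU.connectedComponentIn.mem_nhds (mem_connectedComponentIn (hAU hx)))
  refine (t.finite_toSet.image (connectedComponentIn B)).subset ?_
  rintro _ ⟨x, hx, rfl⟩
  obtain ⟨y, hy, hxy⟩ := Set.mem_iUnion₂.1 (ht hx)
  exact ⟨y, hy, connectedComponentIn_eq (connectedComponentIn_mono y hUB hxy)⟩

theorem ncard_componentsMeeting_box {A A' B B' : Set M} (hA : A ⊆ A') (hAB : A' ⊆ B)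
    (hB : B ⊆ B') (hfin : (componentsMeeting A' B).Finite) :
    (componentsMeeting A' B').ncard + (componentsMeeting A B).ncard ≤
      (componentsMeeting A' B).ncard + (componentsMeeting A B').ncard := by
  have hw : ∀ P ∈ A', ∀ Q ∈ A', connectedComponentIn B P = connectedComponentIn B Q →
      connectedComponentIn B' P = connectedComponentIn B' Q := by
    intro P hP Q hQ h
    refine (connectedComponentIn_eq (connectedComponentIn_mono Q hB ?_)).symm
    rw [← h]
    exact mem_connectedComponentIn (hAB hP)
  have hfac : ∃ w : Set M → Set M, ∀ P ∈ A',
      w (connectedComponentIn B P) = connectedComponentIn B' P := by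
    refine ⟨fun S => {Q | ∃ P ∈ A', connectedComponentIn B P = S ∧
      Q ∈ connectedComponentIn B' P}, fun P hP => ?_⟩
    ext Q
    constructor
    · rintro ⟨R, hR, h1, h2⟩
      rwa [← hw R hR P hP h1]
    · exact fun h => ⟨P, hP, rfl, h⟩
  obtain ⟨w, hw⟩ := hfac
  have himg : ∀ S ⊆ A', componentsMeeting S B' = w '' componentsMeeting S B := by
    intro S hS
    rw [componentsMeeting, componentsMeeting, Set.image_image]
    exact Set.image_congr fun P hP => (hw P (hS hP)).symm
  have hsub : componentsMeeting A B ⊆ componentsMeeting A' B := Set.image_mono hA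
  have hsub' : componentsMeeting A B' ⊆ componentsMeeting A' B' := Set.image_mono hA
  have hfin' : (componentsMeeting A' B').Finite := by
    rw [himg A' subset_rfl]
    exact hfin.image w
  have h1 := Set.ncard_sdiff_add_ncard_of_subset hsub hfin
  have h2 := Set.ncard_sdiff_add_ncard_of_subset hsub' hfin'
  have h3 : (componentsMeeting A' B' \ componentsMeeting A B').ncard ≤
      (componentsMeeting A' B \ componentsMeeting A B).ncard := by
    refine (Set.ncard_le_ncard ?_ ((hfin.sdiff).image w)).trans
      (Set.ncard_image_le (hfin.sdiff))
    rw [himg A' subset_rfl, himg A hA]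
    rintro _ ⟨⟨S, hS, rfl⟩, hnot⟩
    exact ⟨S, ⟨hS, fun h => hnot ⟨S, h, rfl⟩⟩, rfl⟩
  omega

theorem ncard_componentsMeeting_mono {A A' B : Set M} (hA : A ⊆ A')
    (hfin : (componentsMeeting A' B).Finite) :
    (componentsMeeting A B).ncard ≤ (componentsMeeting A' B).ncard :=
  Set.ncard_le_ncard (Set.image_mono hA) hfin

theorem ncard_componentsMeeting_anti {A B B' : Set M} (hAB : A ⊆ B) (hB : B ⊆ B')
    (hfin : (componentsMeeting A B).Finite) :
    (componentsMeeting A B').ncard ≤ (componentsMeeting A B).ncard := by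
  have := ncard_componentsMeeting_box (Set.empty_subset A) hAB hB hfin
  simpa [componentsMeeting] using this

theorem size1_eq_ncard (f : M → ℝ) (s t : ℝ) :
    size1 f s t = (componentsMeeting {P | f P ≤ s} {P | f P ≤ t}).ncard := by
  unfold size1 componentsMeeting
  congr 1
  ext S
  simp [eq_comm]

theorem isRank_ncard_componentsMeeting {A B : ℝ → Set M} (hA : Monotone A) (hB : Monotone B)
    (hAB : ∀ s t, s < t → A s ⊆ B t)
    (hfin : ∀ s t, s < t → (componentsMeeting (A s) (B t)).Finite) :
    IsRank fun s t => (componentsMeeting (A s) (B t)).ncard where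
  mono h1 h2 := ncard_componentsMeeting_mono (hA h1) (hfin _ _ h2)
  anti h1 h2 := ncard_componentsMeeting_anti (hAB _ _ h1) (hB h2) (hfin _ _ h1)
  box h1 h2 h3 := ncard_componentsMeeting_box (hA h1) (hAB _ _ h2) (hB h3) (hfin _ _ h2)

theorem finite_componentsMeeting_sublevel [CompactSpace M] [LocallyConnectedSpace M]
    {f g : M → ℝ} (hf : Continuous f) (hg : Continuous g) {c : ℝ} (h : ∀ P, g P ≤ f P + c)
    {s t : ℝ} (hst : s + c < t) :
    (componentsMeeting {P | f P ≤ s} {P | g P ≤ t}).Finite :=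
  finite_componentsMeeting (isClosed_le hf continuous_const) (isOpen_lt hg continuous_const)
    (fun P (hP : f P ≤ s) => show g P < t by linarith [h P])
    fun P (hP : g P < t) => show g P ≤ t from hP.le

theorem isRank_size1 [CompactSpace M] [LocallyConnectedSpace M] {f : M → ℝ}
    (hf : Continuous f) : IsRank (size1 f) := by
  have := isRank_ncard_componentsMeeting (A := fun s => {P | f P ≤ s})
    (B := fun s => {P | f P ≤ s}) (fun s t h P hP => le_trans hP h)
    (fun s t h P hP => le_trans hP h) (fun s t h P hP => le_trans hP h.le)
    (fun s t h => finite_componentsMeeting_sublevel hf hf (c := 0) (by simp) (by simpa))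
  simpa only [← size1_eq_ncard] using this

end ComponentCount

section Window

variable {ℓ : ℝ → ℝ → ℕ}

/-- The function `ℓ`, translated by `c` and cut off at height `K`. -/
def window (c K : ℝ) (ℓ : ℝ → ℝ → ℕ) (s t : ℝ) : ℕ := if t < K then ℓ (s + c) (t + c) else 0

theorem IsRank.window (hℓ : IsRank ℓ) (c K : ℝ) : IsRank (window c K ℓ) where
  mono {s s' t} h1 h2 := by
    have := hℓ.mono (show s + c ≤ s' + c by linarith) (show s' + c < t + c by linarith)
    unfold SizeTheory.window
    split_ifs <;> omega
  anti {s t t'} h1 h2 := by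
    have := hℓ.anti (show s + c < t + c by linarith) (show t + c ≤ t' + c by linarith)
    unfold SizeTheory.window
    split_ifs <;> first | omega | linarith
  box {s s' t t'} h1 h2 h3 := by
    have i1 := hℓ.box (show s + c ≤ s' + c by linarith) (show s' + c < t + c by linarith)
      (show t + c ≤ t' + c by linarith)
    have i2 := hℓ.mono (show s + c ≤ s' + c by linarith) (show s' + c < t + c by linarith)
    unfold SizeTheory.window
    split_ifs <;> first | omega | linarith

/-- `ℓ s t` no longer depends on `t`, respectively `s`, past `T`. -/
structure StableAbove (ℓ : ℝ → ℝ → ℕ) (T : ℝ) : Prop where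
  left : ∀ {s s'} t, T ≤ s → T ≤ s' → ℓ s t = ℓ s' t
  right : ∀ s {t t'}, T ≤ t → T ≤ t' → ℓ s t = ℓ s t'

theorem stableAbove_size1 {M : Type*} [TopologicalSpace M] {f : M → ℝ} {T : ℝ}
    (hT : ∀ P, f P ≤ T) : StableAbove (size1 f) T where
  left t h1 h2 := by
    have e : ∀ {s}, T ≤ s → {P | f P ≤ s} = Set.univ := fun h =>
      Set.eq_univ_of_forall fun P => (hT P).trans h
    rw [size1_eq_ncard, size1_eq_ncard, e h1, e h2]
  right s t t' h1 h2 := by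
    have e : ∀ {s}, T ≤ s → {P | f P ≤ s} = Set.univ := fun h =>
      Set.eq_univ_of_forall fun P => (hT P).trans h
    rw [size1_eq_ncard, size1_eq_ncard, e h1, e h2]

theorem IsRank.multInf_spec (hℓ : IsRank ℓ) {T : ℝ} (hT : StableAbove ℓ T) (a : ℝ) :
    ∃ ε₀, 0 < ε₀ ∧ ∀ ε, 0 < ε → ε ≤ ε₀ → ∀ t, T ≤ t →
      (ℓ (a + ε) t : ℤ) - (ℓ (a - ε) t : ℤ) = multInf ℓ a := by
  obtain ⟨ε₀, h0, hp, e⟩ := exists_forall_le_eq_sInf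
    (fun ε => (ℓ (a + ε) (1 / ε) : ℤ) - (ℓ (a - ε) (1 / ε) : ℤ))
    (fun ε => a + ε < 1 / ε)
    ⟨1 / (|a| + 2), by positivity, by
      rw [one_div_one_div]
      have h1 : 1 / (|a| + 2) ≤ 1 := by
        rw [div_le_one (by positivity)]
        linarith [abs_nonneg a]
      linarith [le_abs_self a]⟩
    (fun ε ε' h1 h2 h3 => by
      have := one_div_le_one_div_of_le h1 h2
      linarith)
    (fun ε h1 h2 => by
      have := hℓ.mono (show a - ε ≤ a + ε by linarith) h2
      omega)
    (fun ε ε' h1 h2 h3 => by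
      have h4 := one_div_le_one_div_of_le h1 h2
      have i1 := hℓ.mono (show a + ε ≤ a + ε' by linarith) (show a + ε' < 1 / ε by linarith)
      have i2 := hℓ.mono (show a - ε' ≤ a - ε by linarith) (show a - ε < 1 / ε by linarith)
      have i3 := hℓ.box (show a - ε' ≤ a + ε' by linarith) h3 h4
      omega)
  have hT1 : 0 < |T| + 1 := by positivity
  refine ⟨min ε₀ (1 / (|T| + 1)), by positivity, fun ε h1 h2 t ht => ?_⟩
  have h3 : T ≤ 1 / ε := by
    have := one_div_le_one_div_of_le h1 (h2.trans (min_le_right _ _))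
    rw [one_div_one_div] at this
    linarith [le_abs_self T]
  rw [hT.right (a + ε) ht h3, hT.right (a - ε) ht h3]
  exact e ε h1 (h2.trans (min_le_left _ _))

theorem IsRank.le_of_mult_pos (hℓ : IsRank ℓ) {T : ℝ} (hT : StableAbove ℓ T) {x y : ℝ}
    (hxy : x < y) (h : 0 < mult ℓ x y) : y ≤ T := by
  by_contra! hc
  obtain ⟨ε₀, h0, hp, e⟩ := hℓ.mult_spec hxy
  have hm : 0 < min ε₀ (y - T) := lt_min h0 (by linarith)
  have hm' := min_le_right ε₀ (y - T)
  rw [← e _ _ hm (min_le_left _ _) hm (min_le_left _ _),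
    hT.right _ (show T ≤ y - min ε₀ (y - T) by linarith)
      (show T ≤ y + min ε₀ (y - T) by linarith),
    hT.right (x - _) (show T ≤ y - min ε₀ (y - T) by linarith)
      (show T ≤ y + min ε₀ (y - T) by linarith)] at h
  omega

theorem IsRank.le_of_multInf_pos (hℓ : IsRank ℓ) {T : ℝ} (hT : StableAbove ℓ T) {a : ℝ}
    (h : 0 < multInf ℓ a) : a ≤ T := by
  by_contra! hc
  obtain ⟨ε₀, h0, e⟩ := hℓ.multInf_spec hT a
  have hm : 0 < min ε₀ (a - T) := lt_min h0 (by linarith)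
  have hm' := min_le_right ε₀ (a - T)
  rw [← e _ hm (min_le_left _ _) T le_rfl,
    hT.left _ (show T ≤ a + min ε₀ (a - T) by linarith)
      (show T ≤ a - min ε₀ (a - T) by linarith)] at h
  omega

theorem IsRank.mult_window_of_lt (hℓ : IsRank ℓ) {c K x y : ℝ} (hxy : x < y) (hy : y < K) :
    mult (SizeTheory.window c K ℓ) x y = mult ℓ (x + c) (y + c) := by
  obtain ⟨ε₁, h1, -, e₁⟩ := (hℓ.window c K).mult_spec hxy
  obtain ⟨ε₂, h2, -, e₂⟩ := hℓ.mult_spec (show x + c < y + c by linarith)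
  have hm : 0 < min (min ε₁ ε₂) ((K - y) / 2) :=
    lt_min (lt_min h1 h2) (by linarith)
  have i1 := (min_le_left (min ε₁ ε₂) ((K - y) / 2)).trans (min_le_left _ _)
  have i2 := (min_le_left (min ε₁ ε₂) ((K - y) / 2)).trans (min_le_right _ _)
  have i3 := min_le_right (min ε₁ ε₂) ((K - y) / 2)
  rw [← e₁ _ _ hm i1 hm i1, ← e₂ _ _ hm i2 hm i2]
  generalize min (min ε₁ ε₂) ((K - y) / 2) = ε at *
  unfold SizeTheory.window
  rw [if_pos (by linarith), if_pos (by linarith), if_pos (by linarith), if_pos (by linarith)]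
  simp only [add_sub_right_comm, add_right_comm]

theorem IsRank.mult_window_self (hℓ : IsRank ℓ) {T c K x : ℝ} (hT : StableAbove ℓ T) (hc : 0 ≤ c)
    (hTK : T < K) (hx : x < K) :
    mult (SizeTheory.window c K ℓ) x K = multInf ℓ (x + c) := by
  obtain ⟨ε₁, h1, -, e₁⟩ := (hℓ.window c K).mult_spec hx
  obtain ⟨ε₂, h2, e₂⟩ := hℓ.multInf_spec hT (x + c)
  have hm : 0 < min (min ε₁ ε₂) (K - T) := lt_min (lt_min h1 h2) (by linarith)
  have i1 := (min_le_left (min ε₁ ε₂) (K - T)).trans (min_le_left _ _)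
  have i2 := (min_le_left (min ε₁ ε₂) (K - T)).trans (min_le_right _ _)
  have i3 := min_le_right (min ε₁ ε₂) (K - T)
  generalize min (min ε₁ ε₂) (K - T) = ε at *
  rw [← e₁ _ _ hm i1 hm i1, ← e₂ _ hm i2 (K - ε + c) (by linarith)]
  unfold SizeTheory.window
  rw [if_pos (by linarith), if_pos (by linarith), if_neg (by linarith), if_neg (by linarith)]
  simp only [add_sub_right_comm, add_right_comm]
  simp

theorem IsRank.mult_window_of_gt (hℓ : IsRank ℓ) {c K x y : ℝ} (hxy : x < y) (hy : K < y) :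
    mult (SizeTheory.window c K ℓ) x y = 0 := by
  obtain ⟨ε₁, h1, -, e₁⟩ := (hℓ.window c K).mult_spec hxy
  have hm : 0 < min ε₁ (y - K) := lt_min h1 (by linarith)
  have i1 := min_le_left ε₁ (y - K)
  have i3 := min_le_right ε₁ (y - K)
  rw [← e₁ _ _ hm i1 hm i1]
  generalize min ε₁ (y - K) = ε at *
  unfold SizeTheory.window
  rw [if_neg (by linarith), if_neg (by linarith), if_neg (by linarith), if_neg (by linarith)]
  simp

theorem IsRank.bars_window_bounds (hℓ : IsRank ℓ) {T c K : ℝ} (hT : StableAbove ℓ T) (hc : 0 ≤ c)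
    (hTK : T < K) {p : ℝ × ℝ × ℕ} (hp : p ∈ bars (SizeTheory.window c K ℓ)) :
    p.1 + c ≤ T ∧ (p.2.1 + c ≤ T ∨ p.2.1 = K) := by
  obtain ⟨h1, h2⟩ := hp
  have h3 : 0 < mult (SizeTheory.window c K ℓ) p.1 p.2.1 := by omega
  rcases lt_trichotomy p.2.1 K with h | h | h
  · rw [hℓ.mult_window_of_lt h1 h] at h3
    have := hℓ.le_of_mult_pos hT (by linarith) h3
    exact ⟨by linarith, Or.inl this⟩
  · rw [h, hℓ.mult_window_self hT hc hTK (by linarith)] at h3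
    exact ⟨hℓ.le_of_multInf_pos hT h3, Or.inr h⟩
  · rw [hℓ.mult_window_of_gt h1 h] at h3
    omega

theorem CPIdx.ext {m : ℝ × WithTop ℝ → ℕ∞} {a b : CPIdx m} (h : a.1 = b.1)
    (h' : a.2.1 = b.2.1) : a = b := by
  obtain ⟨p, n, hn⟩ := a
  obtain ⟨q, k, hk⟩ := b
  simp only at h h'
  subst h h'
  rfl

@[simp]
theorem cpMult_top (x : ℝ) : cpMult ℓ (x, ⊤) = ((multInf ℓ x).toNat : ℕ∞) := rfl

@[simp]
theorem cpMult_coe (x y : ℝ) : cpMult ℓ (x, (y : WithTop ℝ)) =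
    if x = y then ⊤ else if x < y then ((mult ℓ x y).toNat : ℕ∞) else 0 := rfl

theorem IsRank.exists_bars_window_to_CPIdx (hℓ : IsRank ℓ) {T c K : ℝ} (hT : StableAbove ℓ T)
    (hc : 0 ≤ c) (hTK : T < K) :
    ∃ u : bars (SizeTheory.window c K ℓ) → CPIdx (cpMult ℓ), Function.Injective u ∧
      (∀ p, (u p).1 = (p.1.1 + c, if p.1.2.1 = K then ⊤ else ((p.1.2.1 + c : ℝ) : WithTop ℝ))) ∧
      ∀ a, a ∉ Set.range u → ∃ x : ℝ, a.1 = (x, (x : WithTop ℝ)) := by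
  have hmem : ∀ p : bars (SizeTheory.window c K ℓ), ((p.1.2.2 : ℕ) : ℕ∞) < cpMult ℓ
      (p.1.1 + c, if p.1.2.1 = K then ⊤ else ((p.1.2.1 + c : ℝ) : WithTop ℝ)) := by
    rintro ⟨⟨x, y, n⟩, h1, h2⟩
    simp only at h1 h2 ⊢
    split_ifs with h
    · subst h
      rw [hℓ.mult_window_self hT hc hTK h1] at h2
      rw [cpMult_top, Nat.cast_lt]
      omega
    · rcases lt_or_gt_of_ne h with h | h
      · rw [hℓ.mult_window_of_lt h1 h] at h2
        rw [cpMult_coe, if_neg (by linarith), if_pos (by linarith), Nat.cast_lt]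
        omega
      · rw [hℓ.mult_window_of_gt h1 h] at h2
        omega
  refine ⟨fun p => ⟨_, p.1.2.2, hmem p⟩, ?_, fun p => rfl, ?_⟩
  · rintro ⟨⟨x, y, n⟩, hp⟩ ⟨⟨x', y', n'⟩, hq⟩ h
    have h1 := congrArg (fun a => a.1) h
    have h2 := congrArg (fun a => a.2.1) h
    simp only [Prod.mk.injEq, add_left_inj] at h1 h2
    obtain ⟨h1, h3⟩ := h1
    have h4 : y = y' := by
      split_ifs at h3 with i j j
      · rw [i, j]
      · exact absurd h3.symm WithTop.coe_ne_top
      · exact absurd h3 WithTop.coe_ne_top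
      · exact add_right_cancel (WithTop.coe_injective h3)
    subst h1 h2 h4
    rfl
  · rintro ⟨⟨x, y⟩, n, hn⟩ ha
    induction y using WithTop.recTopCoe with
    | top =>
      refine absurd ⟨⟨(x - c, K, n), ?_⟩, ?_⟩ ha
      · rw [cpMult_top, Nat.cast_lt] at hn
        have := hℓ.le_of_multInf_pos hT (a := x) (by omega)
        have hx : x - c < K := by linarith
        refine ⟨hx, ?_⟩
        simp only
        rw [hℓ.mult_window_self hT hc hTK hx, sub_add_cancel]
        omega
      · exact CPIdx.ext (by simp) rfl
    | coe y =>
      rw [cpMult_coe] at hn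
      split_ifs at hn with h1 h2
      · exact ⟨x, by simp [h1]⟩
      · rw [Nat.cast_lt] at hn
        have := hℓ.le_of_mult_pos hT h2 (by omega)
        have hy : y - c < K := by linarith
        refine absurd ⟨⟨(x - c, y - c, n), ?_⟩, ?_⟩ ha
        · refine ⟨by simpa using h2, ?_⟩
          simp only
          rw [hℓ.mult_window_of_lt (by linarith) hy, sub_add_cancel, sub_add_cancel]
          omega
        · exact CPIdx.ext (by simp [hy.ne]) rfl
      · simp at hn

end Window

section Stability

theorem exists_equiv_extending {α β γ : Type*} {u : γ → α} {v : γ → β}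
    (hu : Function.Injective u) (hv : Function.Injective v)
    (e : ((Set.range u)ᶜ : Set α) ≃ ((Set.range v)ᶜ : Set β)) :
    ∃ σ : α ≃ β, (∀ c, σ (u c) = v c) ∧ ∀ a, a ∉ Set.range u → σ a ∉ Set.range v := by
  classical
  refine ⟨(Equiv.Set.sumCompl (Set.range u)).symm.trans
    ((Equiv.sumCongr ((Equiv.ofInjective u hu).symm.trans (Equiv.ofInjective v hv)) e).trans
      (Equiv.Set.sumCompl (Set.range v))), fun c => ?_, fun a ha => ?_⟩
  · have h : (Equiv.ofInjective u hu).symm ⟨u c, Set.mem_range_self c⟩ = c :=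
      Equiv.ofInjective_symm_apply hu c
    simp only [Equiv.trans_apply]
    rw [Equiv.Set.sumCompl_symm_apply_of_mem (Set.mem_range_self c)]
    simp [h]
  · simp only [Equiv.trans_apply]
    rw [Equiv.Set.sumCompl_symm_apply_of_notMem ha]
    exact (e ⟨a, ha⟩).2

open Cardinal in
theorem mk_compl_eq_continuum {ℓ : ℝ → ℝ → ℕ} {S : Set (CPIdx (cpMult ℓ))}
    (hS : ∀ a ∈ S, ∀ x : ℝ, a.1 ≠ (x, (x : WithTop ℝ))) :
    #(Sᶜ : Set (CPIdx (cpMult ℓ))) = 𝔠 := by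
  refine le_antisymm ?_ ?_
  · have hinj : Function.Injective
        (fun a : (Sᶜ : Set (CPIdx (cpMult ℓ))) => ((a.1.1, a.1.2.1) :
          (ℝ × Option ℝ) × ℕ)) := by
      intro a b h
      exact Subtype.ext (CPIdx.ext (congrArg Prod.fst h) (congrArg Prod.snd h))
    refine (mk_le_of_injective hinj).trans ?_
    simp [mk_real, add_one_eq aleph0_le_continuum]
  · rw [← mk_real]
    have hd : ∀ x : ℝ, ((0 : ℕ) : ℕ∞) < cpMult ℓ (x, (x : WithTop ℝ)) := by
      intro x
      rw [cpMult_coe, if_pos rfl]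
      exact ENat.natCast_lt_top 0
    refine mk_le_of_injective (f := fun x : ℝ =>
      (⟨⟨(x, (x : WithTop ℝ)), 0, hd x⟩, fun h => hS _ h x rfl⟩ :
        (Sᶜ : Set (CPIdx (cpMult ℓ))))) ?_
    intro x y h
    exact congrArg (fun a => a.1.1.1) h

theorem diagHalf_coe (x y : ℝ) :
    diagHalf (x, (y : WithTop ℝ)) = ENNReal.ofReal ((y - x) / 2) := rfl

theorem yDist_coe (x y : ℝ) :
    yDist (x : WithTop ℝ) (y : WithTop ℝ) = ENNReal.ofReal |x - y| := rfl

theorem yDist_top : yDist ⊤ ⊤ = 0 := rfl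

/-- Stability of the matching distance with respect to the measuring function. -/
theorem dMatch_size1_le {M : Type*} [TopologicalSpace M] [CompactSpace M]
    [LocallyConnectedSpace M] {f g : M → ℝ} (hf : Continuous f) (hg : Continuous g) {c : ℝ}
    (hc : 0 ≤ c) (hfg : ∀ P, |f P - g P| ≤ c) :
    dMatch (size1 f) (size1 g) ≤ ENNReal.ofReal c := by
  obtain ⟨T, hTf, hTg, hLf, hLg⟩ : ∃ T : ℝ, (∀ P, f P ≤ T) ∧ (∀ P, g P ≤ T) ∧
      (∀ P, -T < f P) ∧ ∀ P, -T < g P := by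
    obtain ⟨B, hB⟩ := (isCompact_range (hf.abs.add hg.abs)).bddAbove
    have hB' : ∀ P, |f P| + |g P| ≤ B := fun P => hB ⟨P, rfl⟩
    refine ⟨B + 1, fun P => ?_, fun P => ?_, fun P => ?_, fun P => ?_⟩ <;>
    linarith [hB' P, neg_abs_le (f P), neg_abs_le (g P), le_abs_self (f P), le_abs_self (g P),
      abs_nonneg (f P), abs_nonneg (g P)]
  have hgf : ∀ P, g P ≤ f P + c := fun P => by linarith [(abs_le.1 (hfg P)).1]
  have hfg' : ∀ P, f P ≤ g P + c := fun P => by linarith [(abs_le.1 (hfg P)).2]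
  set K := T + 2 * c + 1 with hK
  have hTK : T < K := by linarith
  set i : ℝ → ℝ → ℕ := fun s t =>
    (componentsMeeting {P | f P ≤ s} {P | g P ≤ t + c}).ncard with hi
  have hif : ∀ s t, s < t → (componentsMeeting {P | f P ≤ s} {P | g P ≤ t + c}).Finite :=
    fun s t h => finite_componentsMeeting_sublevel hf hg hgf (by linarith)
  have rf := isRank_size1 hf
  have rg := isRank_size1 hg
  have ri : IsRank i := isRank_ncard_componentsMeeting (A := fun s => {P | f P ≤ s})
    (B := fun t => {P | g P ≤ t + c}) (fun s t h P hP => le_trans hP h)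
    (fun s t h P (hP : g P ≤ s + c) => show g P ≤ t + c by linarith)
    (fun s t h P (hP : f P ≤ s) => show g P ≤ t + c by linarith [hgf P]) hif
  have hff : ∀ s t, s < t → (componentsMeeting {P | f P ≤ s} {P | f P ≤ t}).Finite :=
    fun s t h => finite_componentsMeeting_sublevel hf hf (c := 0) (by simp) (by simpa)
  have hgg : ∀ s t, s < t → (componentsMeeting {P | g P ≤ s} {P | g P ≤ t}).Finite :=
    fun s t h => finite_componentsMeeting_sublevel hg hg (c := 0) (by simp) (by simpa)
  have sf : StableAbove (size1 f) T := stableAbove_size1 hTf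
  have sg : StableAbove (size1 g) T := stableAbove_size1 hTg
  have hhigh : ∀ c' ℓ s t, s < t → K ≤ t → window c' K ℓ s t = 0 := fun c' ℓ s t _ h =>
    if_neg h.not_gt
  have hmono : ∀ {s t}, s ≤ t → {P | g P ≤ s + c} ⊆ {P | g P ≤ t + c} :=
    fun {s t} h P (hP : g P ≤ s + c) => show g P ≤ t + c by linarith
  obtain ⟨m, minj, hm, hm'⟩ := (rf.window 0 K).exists_birth_matching (ri.window 0 K)
    (a := 2 * c) (by linarith) (hhigh _ _) (hhigh _ _)
    (fun s s' t h1 h2 => by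
      unfold window
      split_ifs
      · simp only [add_zero, hi, size1_eq_ncard]
        exact ncard_componentsMeeting_box (fun P hP => le_trans hP h1)
          (fun P hP => le_trans hP h2.le)
          (fun P (hP : f P ≤ t) => show g P ≤ t + c by linarith [hgf P]) (hff _ _ h2)
      · simp)
    (fun s s' t h1 h2 => by
      have hsub : {P | f P ≤ s'} ⊆ {P | g P ≤ t + c} :=
        fun P (hP : f P ≤ s') => show g P ≤ t + c by linarith [hgf P]
      unfold window
      split_ifs
      · simp only [add_zero, hi, size1_eq_ncard]
        exact ncard_componentsMeeting_box (fun P hP => le_trans hP h1) hsub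
          (fun P (hP : g P ≤ t + c) => show f P ≤ t + 2 * c by linarith [hfg' P]) (hif _ _ h2)
      · linarith
      · simpa using ri.mono h1 h2
      · simp)
  obtain ⟨n, ninj, hn, hn'⟩ := (rg.window c K).exists_death_matching (ri.window 0 K)
    (a := 2 * c) (L := -T - c) (by linarith)
    (fun s t h1 h2 => by
      have : {P | g P ≤ s + c} = ∅ := Set.eq_empty_of_forall_notMem
        fun P (hP : g P ≤ s + c) => by linarith [hLg P]
      simp [window, size1_eq_ncard, this, componentsMeeting])
    (fun s t h1 h2 => by
      have : {P | f P ≤ s} = ∅ := Set.eq_empty_of_forall_notMem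
        fun P (hP : f P ≤ s) => by linarith [hLf P]
      simp [window, hi, this, componentsMeeting])
    (fun s t t' h1 h2 => by
      have hA : {P | f P ≤ s} ⊆ {P | g P ≤ s + c} :=
        fun P (hP : f P ≤ s) => show g P ≤ s + c by linarith [hgf P]
      have h3 : s + c < t + c := by linarith
      have hB : {P | g P ≤ s + c} ⊆ {P | g P ≤ t + c} := fun P hP => le_trans hP h3.le
      unfold window
      split_ifs
      · simp only [add_zero, hi, size1_eq_ncard]
        have := ncard_componentsMeeting_box hA hB (hmono h2) (hgg _ _ h3)
        omega
      · simp only [add_zero, hi, size1_eq_ncard]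
        exact ncard_componentsMeeting_mono hA (hgg _ _ h3)
      · linarith
      · simp)
    (fun s t t' h1 h2 => by
      have hA : {P | g P ≤ s - 2 * c + c} ⊆ {P | f P ≤ s} :=
        fun P (hP : g P ≤ s - 2 * c + c) => show f P ≤ s by linarith [hfg' P]
      have hB : {P | f P ≤ s} ⊆ {P | g P ≤ t + c} :=
        fun P (hP : f P ≤ s) => show g P ≤ t + c by linarith [hgf P]
      unfold window
      split_ifs
      · simp only [add_zero, hi, size1_eq_ncard]
        have := ncard_componentsMeeting_box hA hB (hmono h2) (hif _ _ h1)
        omega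
      · simp only [add_zero, hi, size1_eq_ncard]
        exact ncard_componentsMeeting_mono hA (hif _ _ h1)
      · linarith
      · simp)
  obtain ⟨u, uinj, hu, hu'⟩ := rf.exists_bars_window_to_CPIdx sf le_rfl hTK
  obtain ⟨v, vinj, hv, hv'⟩ := rg.exists_bars_window_to_CPIdx sg hc hTK
  have bf := fun p : bars (window 0 K (size1 f)) => rf.bars_window_bounds sf le_rfl hTK p.2
  have bg := fun p : bars (window c K (size1 g)) => rg.bars_window_bounds sg hc hTK p.2
  have hund : ∀ p x, (u p).1 ≠ (x, ((x : ℝ) : WithTop ℝ)) := by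
    intro p x hp
    rw [hu] at hp
    have := p.2.1
    simp only [Prod.mk.injEq] at hp
    obtain ⟨h1, h2⟩ := hp
    split_ifs at h2 with h3
    · exact WithTop.coe_ne_top h2.symm
    · have := WithTop.coe_injective h2
      linarith
  have hvnd : ∀ p x, (v p).1 ≠ (x, ((x : ℝ) : WithTop ℝ)) := by
    intro p x hp
    rw [hv] at hp
    have := p.2.1
    simp only [Prod.mk.injEq] at hp
    obtain ⟨h1, h2⟩ := hp
    split_ifs at h2 with h3
    · exact WithTop.coe_ne_top h2.symm
    · have := WithTop.coe_injective h2
      linarith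
  have hushort : ∀ a, a ∉ Set.range (u ∘ m) → diagHalf a.1 ≤ ENNReal.ofReal c := by
    intro a ha
    by_cases h : a ∈ Set.range u
    · obtain ⟨p, rfl⟩ := h
      have h1 := hm' p fun ⟨q, hq⟩ => ha ⟨q, congrArg u hq⟩
      have h2 := bf p
      rw [hu, if_neg (by intro h3; linarith), diagHalf_coe]
      exact ENNReal.ofReal_le_ofReal (by linarith)
    · obtain ⟨x, hx⟩ := hu' a h
      rw [hx, diagHalf_coe]
      exact ENNReal.ofReal_le_ofReal (by linarith)
  have hvshort : ∀ a, a ∉ Set.range (v ∘ n) → diagHalf a.1 ≤ ENNReal.ofReal c := by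
    intro a ha
    by_cases h : a ∈ Set.range v
    · obtain ⟨p, rfl⟩ := h
      have h1 := hn' p fun ⟨q, hq⟩ => ha ⟨q, congrArg v hq⟩
      have h2 := bg p
      rw [hv, if_neg (by intro h3; linarith), diagHalf_coe]
      exact ENNReal.ofReal_le_ofReal (by linarith)
    · obtain ⟨x, hx⟩ := hv' a h
      rw [hx, diagHalf_coe]
      exact ENNReal.ofReal_le_ofReal (by linarith)
  have hcost : ∀ q, deltaCP (u (m q)).1 (v (n q)).1 ≤ ENNReal.ofReal c := by
    intro q
    obtain ⟨m1, m2, m3⟩ := hm q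
    obtain ⟨n1, n2, n3⟩ := hn q
    refine (min_le_left _ _).trans (max_le ?_ ?_)
    · refine ENNReal.ofReal_le_ofReal ?_
      rw [hu, hv, abs_le]
      constructor <;> simp only <;> linarith
    · have b1 := (bf (m q)).2
      have b2 := (bg (n q)).2
      rw [hu, hv]
      by_cases h : (m q).1.2.1 = K
      · have h' : (n q).1.2.1 = K := by
          rcases b2 with b2 | b2
          · linarith
          · exact b2
        simp only [if_pos h, if_pos h', yDist_top, zero_le]
      · have h' : (n q).1.2.1 ≠ K := by
          intro h'
          rcases b1 with b1 | b1
          · linarith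
          · exact h b1
        simp only [if_neg h, if_neg h', yDist_coe]
        refine ENNReal.ofReal_le_ofReal ?_
        rw [abs_le]
        constructor <;> linarith
  obtain ⟨e⟩ := Cardinal.eq.1
    ((mk_compl_eq_continuum (S := Set.range (u ∘ m)) (by rintro _ ⟨p, rfl⟩; exact hund _)).trans
      (mk_compl_eq_continuum (S := Set.range (v ∘ n)) (by rintro _ ⟨p, rfl⟩; exact hvnd _)).symm)
  obtain ⟨σ, hσ, hσ'⟩ := exists_equiv_extending (uinj.comp minj) (vinj.comp ninj) e
  refine (iInf_le _ σ).trans (iSup_le fun a => ?_)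
  by_cases h : a ∈ Set.range (u ∘ m)
  · obtain ⟨q, rfl⟩ := h
    rw [hσ]
    exact hcost q
  · exact (min_le_right _ _).trans (max_le (hushort _ h) (hvshort _ (hσ' _ h)))

end Stability

section HalfPlanes

variable {M : Type*} {k : ℕ}

theorem continuous_Fpair [TopologicalSpace M] [Nonempty (Fin k)] {φ : M → Fin k → ℝ}
    (hφ : Continuous φ) (l b : Fin k → ℝ) : Continuous (Fpair φ l b) := by
  have : Fpair φ l b = fun P => Finset.univ.sup' Finset.univ_nonempty
      fun i => (φ P i - b i) / l i := by
    ext P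
    rw [Finset.sup'_univ_eq_ciSup]
    rfl
  rw [this]
  refine Continuous.finset_sup'_apply _ fun i _ => ?_
  fun_prop

theorem abs_sub_div_sub_div_le {x l b l' b' ε m A B L : ℝ} (hm : 0 < m) (hε : 0 ≤ ε)
    (hl : ε < l) (hml : m ≤ l * (l - ε)) (hl' : 0 < l') (hll' : |l - l'| ≤ ε)
    (hbb' : |b - b'| ≤ ε) (hx : |x| ≤ A) (hL : |l| ≤ L) (hb : |b| ≤ B) :
    |(x - b) / l - (x - b') / l'| ≤ ε * (A + L + B) / m := by
  have hl0 : 0 < l := hε.trans_lt hl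
  have hdiv : (x - b) / l - (x - b') / l' =
      ((l' - l) * x + (l - l') * b + l * (b' - b)) / (l * l') := by
    field_simp
    ring
  have hle : l * (l - ε) ≤ l * l' :=
    mul_le_mul_of_nonneg_left (by linarith [le_abs_self (l - l')]) hl0.le
  rw [hdiv, abs_div, abs_of_pos (mul_pos hl0 hl')]
  refine div_le_div₀ ?_ ?_ hm (hml.trans hle)
  · exact mul_nonneg hε (by linarith [abs_nonneg x, abs_nonneg l, abs_nonneg b])
  · have h1 : |(l' - l) * x| ≤ ε * A := by
      rw [abs_mul, abs_sub_comm]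
      exact mul_le_mul hll' hx (abs_nonneg _) hε
    have h2 : |(l - l') * b| ≤ ε * B := by
      rw [abs_mul]
      exact mul_le_mul hll' hb (abs_nonneg _) hε
    have h3 : |l * (b' - b)| ≤ L * ε := by
      rw [abs_mul, abs_sub_comm b']
      exact mul_le_mul hL hbb' (abs_nonneg _) ((abs_nonneg _).trans hL)
    have h4 := abs_add_three ((l' - l) * x) ((l - l') * b) (l * (b' - b))
    linarith

theorem abs_Fpair_sub_Fpair_le [Nonempty (Fin k)] (φ : M → Fin k → ℝ) (l b l' b' : Fin k → ℝ)
    {D : ℝ} (P : M) (h : ∀ i, |(φ P i - b i) / l i - (φ P i - b' i) / l' i| ≤ D) :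
    |Fpair φ l b P - Fpair φ l' b' P| ≤ D := by
  have bdd : ∀ u : Fin k → ℝ, BddAbove (Set.range u) := fun u => (Set.finite_range u).bddAbove
  have h1 : Fpair φ l b P ≤ Fpair φ l' b' P + D := ciSup_le fun i => by
    have := le_ciSup (bdd fun i => (φ P i - b' i) / l' i) i
    have := (abs_le.1 (h i)).2
    unfold Fpair
    linarith
  have h2 : Fpair φ l' b' P ≤ Fpair φ l b P + D := ciSup_le fun i => by
    have := le_ciSup (bdd fun i => (φ P i - b i) / l i) i
    have := (abs_le.1 (h i)).1
    unfold Fpair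
    linarith
  rw [abs_le]
  constructor <;> linarith

end HalfPlanes

/-- Stability of the matching distance with respect to the choice of the half-plane of the
foliation. -/
theorem halfplane_stability {k : ℕ} {M : Type*} [TopologicalSpace M] [Nonempty M]
    [CompactSpace M] [LocallyConnectedSpace M] [T2Space M]
    (φ : M → Fin k → ℝ) (hφ : Continuous φ)
    (l b l' b' : Fin k → ℝ) (hadm : Admissible l b) (hadm' : Admissible l' b')
    (ε : ℝ) (hε : 0 < ε) (hεl : ∀ i, ε < l i)
    (hl : ∀ i, |l i - l' i| ≤ ε) (hb : ∀ i, |b i - b' i| ≤ ε) :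
    dMatch (size1 (Fpair φ l b)) (size1 (Fpair φ l' b')) ≤
      ENNReal.ofReal (ε * ((⨆ P : M, ⨆ i, |φ P i|) + (⨆ i, |l i|) + ⨆ i, |b i|) /
        ⨅ i, l i * (l i - ε)) := by
  have hk : Nonempty (Fin k) := by
    by_contra hk
    rw [not_nonempty_iff] at hk
    have := hadm.1
    simp at this
  have bdd : ∀ u : Fin k → ℝ, BddAbove (Set.range u) := fun u => (Set.finite_range u).bddAbove
  have hφb : BddAbove (Set.range fun P : M => ⨆ i, |φ P i|) := by
    obtain ⟨B, hB⟩ := (isCompact_range hφ.norm).bddAbove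
    refine ⟨B, ?_⟩
    rintro _ ⟨P, rfl⟩
    exact ciSup_le fun i => (norm_le_pi_norm (φ P) i).trans (hB ⟨P, rfl⟩)
  have hm : 0 < ⨅ i, l i * (l i - ε) := by
    obtain ⟨i, hi⟩ := exists_eq_ciInf_of_finite (f := fun i => l i * (l i - ε))
    rw [← hi]
    exact mul_pos (hadm.2.1 i) (sub_pos.2 (hεl i))
  have key : ∀ P, |Fpair φ l b P - Fpair φ l' b' P| ≤
      ε * ((⨆ P : M, ⨆ i, |φ P i|) + (⨆ i, |l i|) + ⨆ i, |b i|) /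
        ⨅ i, l i * (l i - ε) := fun P =>
    abs_Fpair_sub_Fpair_le φ l b l' b' P fun i =>
      abs_sub_div_sub_div_le hm hε.le (hεl i) (ciInf_le (Set.finite_range _).bddBelow i)
        (hadm'.2.1 i) (hl i) (hb i)
        ((le_ciSup (bdd fun i => |φ P i|) i).trans (le_ciSup hφb P))
        (le_ciSup (bdd fun i => |l i|) i) (le_ciSup (bdd fun i => |b i|) i)
  exact dMatch_size1_le (continuous_Fpair hφ l b) (continuous_Fpair hφ l' b')
    ((abs_nonneg _).trans (key (Classical.arbitrary M))) key

end SizeTheory
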